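/- For every integer k ≥ 0, real δ > -1 and every fixed index vector with 1 ≤ i_k < ⋯ < i_0, the sequence (E[N_n(i_0,…,i_k)] − n(k+1)p_{i_0,…,i_k})_{n≥1} is bounded, where (p_{i_0,…,i_k}) is the unique solution of the limiting degree recursion. -/

import Mathlib

open MeasureTheory Filter Finset

noncomputable section

/-- The coefficient `b_m = k - m + 1 + δ(k - m)`. -/
def bcoef (k : ℕ) (δ : ℝ) (m : ℕ) : ℝ := (k : ℝ) - m + 1 + δ * ((k : ℝ) - m)

/-- The coefficient `τ = k + 2 + δ(k + 1)`. -/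
def tauc (k : ℕ) (δ : ℝ) : ℝ := (k : ℝ) + 2 + δ * ((k : ℝ) + 1)

/-- A vector `(i_0, …, i_k)` of degrees is valid when `1 ≤ i_k < i_{k-1} < ⋯ < i_0`. -/
def ValidIdx (k : ℕ) (i : Fin (k + 1) → ℕ) : Prop :=
  1 ≤ i (Fin.last k) ∧ StrictAnti i

/-- Decrease every coordinate of the index vector by one. -/
def allDec (k : ℕ) (i : Fin (k + 1) → ℕ) : Fin (k + 1) → ℕ := fun ℓ => i ℓ - 1

/-- Decrease the coordinates `0, …, m` of the index vector by one. -/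
def decUpTo (k : ℕ) (m : ℕ) (i : Fin (k + 1) → ℕ) : Fin (k + 1) → ℕ :=
  fun ℓ => if (ℓ : ℕ) ≤ m then i ℓ - 1 else i ℓ

/-- The limiting degree recursion: `p` vanishes outside the valid index vectors, and on the
valid index vectors it satisfies the recursion of Theorem 2.1 of the paper. -/
def LimitRecursion (k : ℕ) (δ : ℝ) (p : (Fin (k + 1) → ℕ) → ℝ) : Prop :=
  (∀ i, ¬ ValidIdx k i → p i = 0) ∧
  ∀ i, ValidIdx k i →
    p i = ((i (Fin.last k) : ℝ) - 1 + δ) / tauc k δ * p (allDec k i)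
      + (∑ m : Fin k,
          (((i m.castSucc : ℝ) - 1 - k + (m : ℕ)) * bcoef k δ (m : ℕ)
            - ((i m.succ : ℝ) - k + (m : ℕ) + 1) * bcoef k δ ((m : ℕ) + 1)) / tauc k δ
            * p (decUpTo k (m : ℕ) i))
      - (((i 0 : ℝ) - k) * bcoef k δ 0 + δ) / tauc k δ * p i
      + (if ∀ ℓ : Fin (k + 1), i ℓ = k - (ℓ : ℕ) + 1 then (1 : ℝ) else 0)

instance : MeasurableSpace (Finset ℕ) := ⊤
instance : MeasurableSpace (Finset (Finset ℕ)) := ⊤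

/-- The `m`-degree of an `m`-simplex `s` in the simplicial complex `g`: the number of
`(m+1)`-simplices (i.e. sets of cardinality `m+2`) of `g` containing `s`. -/
def simDeg (m : ℕ) (g : Finset (Finset ℕ)) (s : Finset ℕ) : ℕ :=
  (g.filter fun t => s ⊆ t ∧ t.card = m + 2).card

/-- The initial complex: one `(k+1)`-simplex on the vertex set `{1, …, k+2}` together
with all its (nonempty) subsimplices. -/
def initComplex (k : ℕ) : Finset (Finset ℕ) :=
  (Finset.Icc 1 (k + 2)).powerset.filter fun s => s.Nonempty

/-- Add to `g` the simplex `s ∪ {v}` together with all of its (nonempty) subsimplices. -/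
def addSimplex (g : Finset (Finset ℕ)) (s : Finset ℕ) (v : ℕ) : Finset (Finset ℕ) :=
  g ∪ (insert v s).powerset.filter fun t => t.Nonempty

/-- The set of `k`-simplices (sets of cardinality `k+1`) of the complex `g`. -/
def kSimplices (k : ℕ) (g : Finset (Finset ℕ)) : Finset (Finset ℕ) :=
  g.filter fun s => s.card = k + 1

/-- The preferential attachment simplicial complex with parameters `k` and `δ`:
`G n ω` is the complex at time `n`, `choice n ω` is the `k`-simplex selected by the vertex
arriving at time `n ≥ 1`, chosen among the `k`-simplices of `G (n-1)` with conditional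
probability proportional to its `k`-degree plus `δ`. -/
structure PAComplex (k : ℕ) (δ : ℝ) (Ω : Type*) [MeasurableSpace Ω] where
  μ : Measure Ω
  isProb : IsProbabilityMeasure μ
  G : ℕ → Ω → Finset (Finset ℕ)
  choice : ℕ → Ω → Finset ℕ
  meas_G : ∀ n, Measurable (G n)
  meas_choice : ∀ n, Measurable (choice n)
  init : ∀ ω, G 0 ω = initComplex k
  choice_mem : ∀ n ω, 1 ≤ n → choice n ω ∈ kSimplices k (G (n - 1) ω)
  step : ∀ n ω, 1 ≤ n → G n ω = addSimplex (G (n - 1) ω) (choice n ω) (n + k + 2)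
  cond_law : ∀ n : ℕ, 1 ≤ n → ∀ g : ℕ → Finset (Finset ℕ),
    ∀ s ∈ kSimplices k (g (n - 1)),
      μ {ω | choice n ω = s ∧ ∀ j < n, G j ω = g j}
        = ENNReal.ofReal (((simDeg k (g (n - 1)) s : ℝ) + δ) /
            ∑ t ∈ kSimplices k (g (n - 1)), ((simDeg k (g (n - 1)) t : ℝ) + δ)) *
          μ {ω | ∀ j < n, G j ω = g j}

/-- The `c` largest vertices of the simplex `s` (so for an enumeration
`s = {v_0 < v_1 < ⋯ < v_k}` and `c = m+1` this is the youngest `m`-simplex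
`{v_{k-m}, …, v_k}`). -/
def topSub (s : Finset ℕ) (c : ℕ) : Finset ℕ :=
  s.filter fun v => (s.filter fun w => v < w).card < c

/-- `Ncount k g i` is the number of `k`-simplices `s = {v_0 < ⋯ < v_k}` of `g` such that
for each `m = 0, …, k` the `m`-degree of the youngest `m`-simplex `{v_{k-m}, …, v_k}`
equals `i m`. -/
def Ncount (k : ℕ) (g : Finset (Finset ℕ)) (i : Fin (k + 1) → ℕ) : ℕ :=
  ((kSimplices k g).filter fun s =>
    ∀ m : Fin (k + 1), simDeg (m : ℕ) g (topSub s ((m : ℕ) + 1)) = i m).card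

/-- The number of members of `g` of cardinality `j` containing `s`. -/
def upCount (j : ℕ) (g : Finset (Finset ℕ)) (s : Finset ℕ) : ℕ :=
  #{t ∈ g | s ⊆ t ∧ t.card = j}

lemma card_filter_subset_powerset (σ a : Finset ℕ) (ha : a ⊆ σ) (j : ℕ) (hj : a.card ≤ j) :
    #{u ∈ σ.powerset | a ⊆ u ∧ u.card = j} = (σ.card - a.card).choose (j - a.card) := by
  rw [← card_sdiff_of_subset ha, ← card_powersetCard]
  refine card_bij' (fun u _ => u \ a) (fun u _ => u ∪ a) ?_ ?_ ?_ ?_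
  · intro u hu
    simp only [mem_filter, mem_powerset] at hu
    rw [mem_powersetCard]
    exact ⟨sdiff_subset_sdiff hu.1 subset_rfl, by rw [card_sdiff_of_subset hu.2.1, hu.2.2]⟩
  · intro u hu
    rw [mem_powersetCard] at hu
    simp only [mem_filter, mem_powerset]
    refine ⟨union_subset (hu.1.trans sdiff_subset) ha, subset_union_right, ?_⟩
    rw [card_union_of_disjoint (disjoint_of_subset_left hu.1 sdiff_disjoint)]
    omega
  · intro u hu
    simp only [mem_filter, mem_powerset] at hu
    exact sdiff_union_of_subset hu.2.1
  · intro u hu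
    rw [mem_powersetCard] at hu
    exact union_sdiff_cancel_right (disjoint_of_subset_left hu.1 sdiff_disjoint)

lemma addSimplex_eq_union_image {g : Finset (Finset ℕ)} {σ : Finset ℕ} (v : ℕ)
    (hdown : ∀ t ∈ g, ∀ u ⊆ t, u.Nonempty → u ∈ g) (hσ : σ ∈ g) :
    addSimplex g σ v = g ∪ σ.powerset.image (insert v) := by
  ext t
  simp only [addSimplex, mem_union, mem_filter, mem_powerset, mem_image]
  constructor
  · rintro (h | ⟨h, h'⟩)
    · exact Or.inl h
    · by_cases hv : v ∈ t
      · exact Or.inr ⟨t.erase v, by rwa [← subset_insert_iff], insert_erase hv⟩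
      · exact Or.inl (hdown σ hσ t ((subset_insert_iff_of_notMem hv).1 h) h')
  · rintro (h | ⟨u, h, rfl⟩)
    · exact Or.inl h
    · exact Or.inr ⟨insert_subset_insert v h, insert_nonempty v u⟩

lemma card_filter_addSimplex {g : Finset (Finset ℕ)} {σ : Finset ℕ} {v : ℕ}
    (hdown : ∀ t ∈ g, ∀ u ⊆ t, u.Nonempty → u ∈ g) (hσ : σ ∈ g) (hv : ∀ t ∈ g, v ∉ t)
    (P : Finset ℕ → Prop) [DecidablePred P] :
    #{t ∈ addSimplex g σ v | P t} = #{t ∈ g | P t} + #{u ∈ σ.powerset | P (insert v u)} := by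
  rw [addSimplex_eq_union_image v hdown hσ, filter_union, card_union_of_disjoint, filter_image,
    card_image_of_injOn]
  · intro a ha b hb hab
    simp only [coe_filter, mem_powerset, Set.mem_ofPred_eq] at ha hb
    have h1 : v ∉ a := fun h => hv σ hσ (ha.1 h)
    have h2 : v ∉ b := fun h => hv σ hσ (hb.1 h)
    rw [← erase_insert h1, ← erase_insert h2]
    exact congrArg (fun t => t.erase v) hab
  · rw [disjoint_left]
    intro t ht ht'
    simp only [mem_filter, mem_image] at ht ht'
    obtain ⟨⟨u, -, rfl⟩, -⟩ := ht'
    exact hv _ ht.1 (mem_insert_self v u)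

lemma upCount_addSimplex_of_notMem {k j : ℕ} {g : Finset (Finset ℕ)} {σ s : Finset ℕ} {v : ℕ}
    (hdown : ∀ t ∈ g, ∀ u ⊆ t, u.Nonempty → u ∈ g) (hσ : σ ∈ g) (hv : ∀ t ∈ g, v ∉ t)
    (hcard : σ.card = k + 1) (hs : v ∉ s) (hj : s.card < j) :
    upCount j (addSimplex g σ v) s =
      upCount j g s + if s ⊆ σ then (k + 1 - s.card).choose (j - s.card - 1) else 0 := by
  rw [upCount, card_filter_addSimplex hdown hσ hv, ← upCount]
  congr 1
  have hvσ := hv σ hσ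
  have key : σ.powerset.filter (fun u => s ⊆ insert v u ∧ (insert v u).card = j) =
      σ.powerset.filter (fun u => s ⊆ u ∧ u.card = j - 1) := by
    refine filter_congr fun u hu => ?_
    have hvu : v ∉ u := fun h => hvσ (mem_powerset.1 hu h)
    rw [subset_insert_iff_of_notMem hs, card_insert_of_notMem hvu]
    exact and_congr_right fun _ => by omega
  rw [key]
  split_ifs with h
  · rw [card_filter_subset_powerset σ s h _ (by omega), hcard]
    congr 1
    omega
  · rw [card_eq_zero, filter_eq_empty_iff]
    exact fun u hu hu' => h (hu'.1.trans (mem_powerset.1 hu))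

lemma upCount_addSimplex_of_mem {k j : ℕ} {g : Finset (Finset ℕ)} {σ s : Finset ℕ} {v : ℕ}
    (hdown : ∀ t ∈ g, ∀ u ⊆ t, u.Nonempty → u ∈ g) (hσ : σ ∈ g) (hv : ∀ t ∈ g, v ∉ t)
    (hcard : σ.card = k + 1) (hs : v ∈ s) (hsσ : s ⊆ insert v σ) (hj : s.card ≤ j) :
    upCount j (addSimplex g σ v) s = (k + 2 - s.card).choose (j - s.card) := by
  rw [upCount, card_filter_addSimplex hdown hσ hv]
  have hvσ := hv σ hσ
  have hpos : 0 < s.card := card_pos.2 ⟨v, hs⟩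
  have h0 : #{t ∈ g | s ⊆ t ∧ t.card = j} = 0 := by
    rw [card_eq_zero, filter_eq_empty_iff]
    exact fun t ht h => hv t ht (h.1 hs)
  have key : σ.powerset.filter (fun u => s ⊆ insert v u ∧ (insert v u).card = j) =
      σ.powerset.filter (fun u => s.erase v ⊆ u ∧ u.card = j - 1) := by
    refine filter_congr fun u hu => ?_
    have hvu : v ∉ u := fun h => hvσ (mem_powerset.1 hu h)
    rw [subset_insert_iff, card_insert_of_notMem hvu]
    exact and_congr_right fun _ => by omega
  have hc := card_erase_of_mem hs
  rw [h0, zero_add, key, card_filter_subset_powerset σ _ (subset_insert_iff.1 hsσ) _ (by omega),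
    hcard, hc]
  congr 1 <;> omega

/-- The deterministic properties shared by all realisations of the complex at time `n`. -/
structure IsPAState (k n : ℕ) (g : Finset (Finset ℕ)) : Prop where
  vert : ∀ t ∈ g, ∀ v ∈ t, v < n + k + 3
  down : ∀ t ∈ g, ∀ u ⊆ t, u.Nonempty → u ∈ g
  nonempty : ∀ t ∈ g, t.Nonempty
  count : ∀ s, s ∈ g ∨ s = ∅ → s.card ≤ k + 1 → ∀ j, s.card < j →
    upCount j g s = upCount (k + 2) g s * (k + 1 - s.card).choose (j - s.card - 1) +
      (k + 1 - s.card).choose (j - s.card)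
  pos : ∀ s ∈ g, s.card ≤ k + 1 → 1 ≤ upCount (k + 2) g s
  total : upCount (k + 2) g ∅ = n + 1

lemma choose_succ_sub {a b c : ℕ} (ha : c ≤ a) (hb : c < b) :
    (a + 1 - c).choose (b - c) = (a - c).choose (b - c - 1) + (a - c).choose (b - c) := by
  obtain ⟨d, rfl⟩ := Nat.exists_eq_add_of_lt hb
  rw [Nat.sub_add_comm ha, show c + d + 1 - c = d + 1 by omega, Nat.choose_succ_succ]
  rfl

lemma upCount_initComplex {k j : ℕ} {s : Finset ℕ} (hs : s ⊆ Icc 1 (k + 2)) (hj : s.card ≤ j)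
    (hj0 : 0 < j) : upCount j (initComplex k) s = (k + 2 - s.card).choose (j - s.card) := by
  have h := card_filter_subset_powerset (Icc 1 (k + 2)) s hs j hj
  rw [Nat.card_Icc, Nat.add_sub_cancel] at h
  rw [← h, upCount, initComplex, filter_filter]
  congr 1
  refine filter_congr fun t _ => ?_
  constructor
  · exact fun h => h.2
  · exact fun h => ⟨card_pos.1 (by omega), h⟩

lemma isPAState_initComplex (k : ℕ) : IsPAState k 0 (initComplex k) := by
  have hsub : ∀ s, s ∈ initComplex k ∨ s = ∅ → s ⊆ Icc 1 (k + 2) := by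
    rintro s (hs | rfl)
    · exact mem_powerset.1 (mem_filter.1 hs).1
    · exact empty_subset _
  have htop : ∀ s, s ∈ initComplex k ∨ s = ∅ → s.card ≤ k + 1 →
      upCount (k + 2) (initComplex k) s = 1 := by
    intro s hs hc
    rw [upCount_initComplex (hsub s hs) (by omega) (by omega), Nat.choose_self]
  refine ⟨?_, ?_, ?_, ?_, ?_, ?_⟩
  · intro t ht v hv
    have := mem_Icc.1 (hsub t (Or.inl ht) hv)
    omega
  · intro t ht u hu hne
    exact mem_filter.2 ⟨mem_powerset.2 (hu.trans (hsub t (Or.inl ht))), hne⟩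
  · exact fun t ht => (mem_filter.1 ht).2
  · intro s hs hc j hj
    rw [htop s hs hc, upCount_initComplex (hsub s hs) hj.le (by omega), one_mul]
    exact choose_succ_sub hc hj
  · exact fun s hs hc => (htop s (Or.inl hs) hc).ge
  · exact htop ∅ (Or.inr rfl) (by simp)

lemma IsPAState.fresh {k n : ℕ} {g : Finset (Finset ℕ)} (h : IsPAState k n g) :
    ∀ t ∈ g, n + k + 3 ∉ t := fun t ht hv => (h.vert t ht _ hv).false

lemma IsPAState.succ {k n : ℕ} {g : Finset (Finset ℕ)} (h : IsPAState k n g)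
    {σ : Finset ℕ} (hσ : σ ∈ kSimplices k g) :
    IsPAState k (n + 1) (addSimplex g σ (n + k + 3)) := by
  obtain ⟨hσg, hσc⟩ := mem_filter.1 hσ
  have hv := h.fresh
  set v := n + k + 3 with hvdef
  have heq := addSimplex_eq_union_image v h.down hσg
  have hmem : ∀ t, t ∈ addSimplex g σ v ↔ t ∈ g ∨ (v ∈ t ∧ t ⊆ insert v σ) := by
    intro t
    rw [heq, mem_union, mem_image]
    refine or_congr_right ⟨?_, ?_⟩
    · rintro ⟨u, hu, rfl⟩
      exact ⟨mem_insert_self v u, insert_subset_insert v (mem_powerset.1 hu)⟩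
    · rintro ⟨hvt, ht⟩
      exact ⟨t.erase v, mem_powerset.2 (by rwa [← subset_insert_iff]), insert_erase hvt⟩
  refine ⟨?_, ?_, ?_, ?_, ?_, ?_⟩
  · intro t ht w hw
    rcases (hmem t).1 ht with ht | ⟨-, ht⟩
    · have := h.vert t ht w hw
      omega
    · rcases mem_insert.1 (ht hw) with rfl | hw
      · omega
      · have := h.vert σ hσg w hw
        omega
  · intro t ht u hu hne
    rcases (hmem t).1 ht with ht | ⟨-, ht⟩
    · exact (hmem u).2 (Or.inl (h.down t ht u hu hne))
    · by_cases hvu : v ∈ u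
      · exact (hmem u).2 (Or.inr ⟨hvu, hu.trans ht⟩)
      · exact (hmem u).2 (Or.inl (h.down σ hσg u
          ((subset_insert_iff_of_notMem hvu).1 (hu.trans ht)) hne))
  · intro t ht
    rcases (hmem t).1 ht with ht | ⟨ht, -⟩
    · exact h.nonempty t ht
    · exact ⟨v, ht⟩
  · intro s hs hc j hj
    have hs' : (s ∈ g ∨ s = ∅) ∨ (v ∈ s ∧ s ⊆ insert v σ) := by
      rw [hmem] at hs
      tauto
    rcases hs' with hs' | ⟨hvs, hsσ⟩
    · have hvs : v ∉ s := by
        rcases hs' with hs' | rfl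
        · exact hv s hs'
        · simp
      rw [upCount_addSimplex_of_notMem h.down hσg hv hσc hvs hj,
        upCount_addSimplex_of_notMem h.down hσg hv hσc hvs (by omega : s.card < k + 2),
        h.count s hs' hc j hj, show k + 2 - s.card - 1 = k + 1 - s.card by omega,
        Nat.choose_self]
      split_ifs <;> ring
    · rw [upCount_addSimplex_of_mem h.down hσg hv hσc hvs hsσ hj.le,
        upCount_addSimplex_of_mem h.down hσg hv hσc hvs hsσ (by omega), Nat.choose_self, one_mul]
      exact choose_succ_sub hc hj
  · intro s hs hc
    rcases (hmem s).1 hs with hs | ⟨hvs, hsσ⟩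
    · rw [upCount_addSimplex_of_notMem h.down hσg hv hσc (hv s hs) (by omega)]
      exact (h.pos s hs hc).trans (Nat.le_add_right _ _)
    · rw [upCount_addSimplex_of_mem h.down hσg hv hσc hvs hsσ (by omega), Nat.choose_self]
  · rw [upCount_addSimplex_of_notMem h.down hσg hv hσc (by simp) (by simp), h.total]
    simp

lemma PAComplex.isPAState {k : ℕ} {δ : ℝ} {Ω : Type*} [MeasurableSpace Ω] (M : PAComplex k δ Ω)
    (n : ℕ) (ω : Ω) : IsPAState k n (M.G n ω) := by
  induction n with
  | zero => rw [M.init]; exact isPAState_initComplex k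
  | succ n ih =>
    have h := M.choice_mem (n + 1) ω (by omega)
    rw [M.step (n + 1) ω (by omega), show n + 1 + k + 2 = n + k + 3 by omega]
    exact ih.succ h

lemma upCount_anti {j : ℕ} {g : Finset (Finset ℕ)} {s t : Finset ℕ} (hst : s ⊆ t) :
    upCount j g t ≤ upCount j g s :=
  card_le_card fun _ hu => by
    simp only [mem_filter] at hu ⊢
    exact ⟨hu.1, hst.trans hu.2.1, hu.2.2⟩

lemma IsPAState.simDeg_eq {k n m : ℕ} {g : Finset (Finset ℕ)} (h : IsPAState k n g)
    {s : Finset ℕ} (hs : s ∈ g) (hc : s.card = m + 1) (hm : m ≤ k) :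
    simDeg m g s = upCount (k + 2) g s + (k - m) := by
  have := h.count s (Or.inl hs) (by omega) (m + 2) (by omega)
  rw [hc, show m + 2 - (m + 1) - 1 = 0 by omega, show m + 2 - (m + 1) = 1 by omega,
    Nat.choose_zero_right, Nat.choose_one_right, show k + 1 - (m + 1) = k - m by omega,
    mul_one] at this
  exact this

lemma IsPAState.card_kSimplices {k n : ℕ} {g : Finset (Finset ℕ)} (h : IsPAState k n g)
    {s : Finset ℕ} (hs : s ∈ g ∨ s = ∅) (hc : s.card ≤ k + 1) :
    #{t ∈ kSimplices k g | s ⊆ t} = upCount (k + 2) g s * (k + 1 - s.card) + 1 := by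
  have h1 : #{t ∈ kSimplices k g | s ⊆ t} = upCount (k + 1) g s := by
    rw [kSimplices, filter_filter, upCount]
    simp only [and_comm]
  rw [h1]
  rcases hc.lt_or_eq with hc' | hc'
  · rw [h.count s hs hc (k + 1) hc', Nat.choose_self]
    obtain ⟨d, hd⟩ := Nat.exists_eq_add_of_lt hc'
    rw [show k + 1 - s.card = d + 1 by omega, Nat.add_sub_cancel, Nat.choose_succ_self_right]
  · rw [hc', Nat.sub_self, mul_zero, zero_add, upCount, card_eq_one]
    refine ⟨s, ?_⟩
    ext t
    simp only [mem_filter, mem_singleton]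
    constructor
    · rintro ⟨-, hst, ht⟩
      exact (eq_of_subset_of_card_le hst (by omega)).symm
    · rintro rfl
      refine ⟨?_, subset_rfl, hc'⟩
      rcases hs with hs | rfl
      · exact hs
      · simp at hc'

lemma IsPAState.sum_simDeg {k n : ℕ} {g : Finset (Finset ℕ)} (h : IsPAState k n g)
    {s : Finset ℕ} (hc : s.card ≤ k + 1) :
    ∑ t ∈ kSimplices k g with s ⊆ t, simDeg k g t = upCount (k + 2) g s * (k + 2 - s.card) := by
  have h1 := sum_card_bipartiteAbove_eq_sum_card_bipartiteBelow (fun t f : Finset ℕ => t ⊆ f)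
    (s := {t ∈ kSimplices k g | s ⊆ t}) (t := {f ∈ g | s ⊆ f ∧ f.card = k + 2})
  have h2 : ∀ t ∈ {t ∈ kSimplices k g | s ⊆ t},
      #(bipartiteAbove (fun t f : Finset ℕ => t ⊆ f) {f ∈ g | s ⊆ f ∧ f.card = k + 2} t) =
        simDeg k g t := by
    intro t ht
    have hst := (mem_filter.1 ht).2
    rw [bipartiteAbove, filter_filter, simDeg]
    congr 1
    refine filter_congr fun f _ => ?_
    constructor
    · exact fun hf => ⟨hf.2, hf.1.2⟩
    · exact fun hf => ⟨⟨hst.trans hf.1, hf.2⟩, hf.1⟩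
  have h3 : ∀ f ∈ {f ∈ g | s ⊆ f ∧ f.card = k + 2},
      #(bipartiteBelow (fun t f : Finset ℕ => t ⊆ f) {t ∈ kSimplices k g | s ⊆ t} f) =
        k + 2 - s.card := by
    intro f hf
    obtain ⟨hfg, hsf, hfc⟩ := mem_filter.1 hf
    have h4 := card_filter_subset_powerset f s hsf (k + 1) hc
    rw [hfc, show k + 2 - s.card = k + 1 - s.card + 1 by omega, Nat.choose_succ_self_right] at h4
    rw [show k + 2 - s.card = k + 1 - s.card + 1 by omega, ← h4, bipartiteBelow, kSimplices,
      filter_filter, filter_filter]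
    congr 1
    ext t
    simp only [mem_filter, mem_powerset]
    constructor
    · rintro ⟨-, h5, h6, h7⟩
      exact ⟨h7, h6, h5⟩
    · rintro ⟨h5, h6, h7⟩
      exact ⟨h.down f hfg t h5 (card_pos.1 (by omega)), h7, h6, h5⟩
  rw [sum_congr rfl h2, sum_congr rfl h3, sum_const, smul_eq_mul] at h1
  exact h1

/-- The total weight `D + δ` of the `k`-simplices of `g` containing `s`. -/
def simWeight (k : ℕ) (δ : ℝ) (g : Finset (Finset ℕ)) (s : Finset ℕ) : ℝ :=
  ∑ t ∈ kSimplices k g with s ⊆ t, ((simDeg k g t : ℝ) + δ)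

lemma IsPAState.simWeight_eq {k n : ℕ} {g : Finset (Finset ℕ)} (h : IsPAState k n g) (δ : ℝ)
    {s : Finset ℕ} (hs : s ∈ g ∨ s = ∅) (hc : s.card ≤ k + 1) :
    simWeight k δ g s = upCount (k + 2) g s * ((k : ℝ) + 2 - s.card) +
      δ * (upCount (k + 2) g s * ((k : ℝ) + 1 - s.card) + 1) := by
  rw [simWeight, sum_add_distrib, sum_const, h.card_kSimplices hs hc, ← Nat.cast_sum,
    h.sum_simDeg hc, nsmul_eq_mul]
  push_cast [Nat.cast_sub hc, Nat.cast_sub (hc.trans (Nat.le_succ _))]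
  ring

lemma IsPAState.simWeight_simplex {k n m : ℕ} {g : Finset (Finset ℕ)} (h : IsPAState k n g)
    (δ : ℝ) {s : Finset ℕ} (hs : s ∈ g) (hc : s.card = m + 1) (hm : m ≤ k) :
    simWeight k δ g s = ((simDeg m g s : ℝ) - k + m) * bcoef k δ m + δ := by
  rw [h.simWeight_eq δ (Or.inl hs) (by omega), h.simDeg_eq hs hc hm, hc, bcoef]
  push_cast [Nat.cast_sub hm]
  ring

lemma IsPAState.simWeight_total {k n : ℕ} {g : Finset (Finset ℕ)} (h : IsPAState k n g) (δ : ℝ) :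
    ∑ t ∈ kSimplices k g, ((simDeg k g t : ℝ) + δ) = tauc k δ * (n + 1) + δ := by
  have := h.simWeight_eq δ (s := ∅) (Or.inr rfl) (by simp)
  rw [simWeight, h.total] at this
  simp only [empty_subset, filter_true] at this
  rw [this, tauc]
  push_cast [card_empty]
  ring

lemma topSub_subset (s : Finset ℕ) (c : ℕ) : topSub s c ⊆ s := filter_subset _ _

lemma topSub_mono (s : Finset ℕ) {c d : ℕ} (h : c ≤ d) : topSub s c ⊆ topSub s d :=
  monotone_filter_right s fun _ _ hv => lt_of_lt_of_le hv h

lemma card_topSub {s : Finset ℕ} {c : ℕ} (hc : c ≤ s.card) : (topSub s c).card = c := by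
  set rank : ℕ → ℕ := fun v => #{w ∈ s | v < w} with hrank
  have hlt : ∀ v ∈ s, ∀ w ∈ s, v < w → rank w < rank v := by
    intro v _ w hw hvw
    refine card_lt_card ⟨monotone_filter_right s fun _ _ hx => hvw.trans hx, fun hsub => ?_⟩
    exact (mem_filter.1 (hsub (mem_filter.2 ⟨hw, hvw⟩))).2.false
  have hinj : Set.InjOn rank s := by
    intro v hv w hw hvw
    rcases lt_trichotomy v w with h | h | h
    · exact absurd hvw (hlt v hv w hw h).ne'
    · exact h
    · exact absurd hvw (hlt w hw v hv h).ne
  have himage : s.image rank = range s.card := by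
    refine eq_of_subset_of_card_le (fun r hr => ?_) ?_
    · obtain ⟨v, hv, rfl⟩ := mem_image.1 hr
      refine mem_range.2 (card_lt_card (filter_ssubset.2 ⟨v, hv, lt_irrefl v⟩))
    · rw [card_range, card_image_of_injOn hinj]
  have h1 : (topSub s c).image rank = range c := by
    have : topSub s c = s.filter fun v => rank v < c := rfl
    rw [this]
    refine (filter_image (f := rank) (s := s) (p := fun r => r < c)).symm.trans ?_
    rw [himage]
    ext r
    simp only [mem_filter, mem_range]
    omega
  rw [← card_image_of_injOn (hinj.mono (topSub_subset s c)), h1, card_range]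

lemma mem_topSub_of_forall_le {s : Finset ℕ} {c v : ℕ} (hv : v ∈ s) (hmax : ∀ w ∈ s, w ≤ v)
    (hc : 0 < c) : v ∈ topSub s c := by
  refine mem_filter.2 ⟨hv, ?_⟩
  rwa [filter_eq_empty_iff.2 fun w hw => not_lt.2 (hmax w hw), card_empty]

/-- The degrees of the youngest subsimplices of `s`, indexed by their dimension. -/
def degVec (k : ℕ) (g : Finset (Finset ℕ)) (s : Finset ℕ) : Fin (k + 1) → ℕ :=
  fun m => simDeg m g (topSub s (m + 1))

lemma IsPAState.topSub_mem {k n : ℕ} {g : Finset (Finset ℕ)} (h : IsPAState k n g)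
    {s : Finset ℕ} (hs : s ∈ kSimplices k g) {m : ℕ} (hm : m ≤ k) :
    topSub s (m + 1) ∈ g ∧ (topSub s (m + 1)).card = m + 1 := by
  obtain ⟨hsg, hsc⟩ := mem_filter.1 hs
  have hc := card_topSub (s := s) (c := m + 1) (by omega)
  exact ⟨h.down s hsg _ (topSub_subset s _) (card_pos.1 (by omega)), hc⟩

lemma IsPAState.degVec_valid {k n : ℕ} {g : Finset (Finset ℕ)} (h : IsPAState k n g)
    {s : Finset ℕ} (hs : s ∈ kSimplices k g) : ValidIdx k (degVec k g s) := by
  have hdeg : ∀ m : Fin (k + 1), degVec k g s m =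
      upCount (k + 2) g (topSub s (m + 1)) + (k - m) := fun m =>
    h.simDeg_eq (h.topSub_mem hs (by omega)).1 (h.topSub_mem hs (by omega)).2 (by omega)
  constructor
  · rw [hdeg]
    have := h.topSub_mem hs le_rfl
    exact (h.pos _ this.1 (by omega)).trans (Nat.le_add_right _ _)
  · intro a b hab
    rw [hdeg, hdeg]
    have hab' : (a : ℕ) < b := hab
    have := upCount_anti (j := k + 2) (g := g) (topSub_mono s (by omega : (a : ℕ) + 1 ≤ b + 1))
    omega

lemma Ncount_eq (k : ℕ) (g : Finset (Finset ℕ)) (i : Fin (k + 1) → ℕ) :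
    Ncount k g i = #{s ∈ kSimplices k g | degVec k g s = i} := by
  simp only [Ncount, degVec, funext_iff]

lemma IsPAState.Ncount_eq_zero {k n : ℕ} {g : Finset (Finset ℕ)} (h : IsPAState k n g)
    {i : Fin (k + 1) → ℕ} (hi : ¬ ValidIdx k i) : Ncount k g i = 0 := by
  rw [Ncount_eq, card_eq_zero, filter_eq_empty_iff]
  rintro s hs rfl
  exact hi (h.degVec_valid hs)

lemma IsPAState.degVec_addSimplex {k n : ℕ} {g : Finset (Finset ℕ)} (h : IsPAState k n g)
    {s σ : Finset ℕ} (hs : s ∈ kSimplices k g) (hσ : σ ∈ kSimplices k g) (m : Fin (k + 1)) :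
    degVec k (addSimplex g σ (n + k + 3)) s m =
      degVec k g s m + if topSub s (m + 1) ⊆ σ then 1 else 0 := by
  obtain ⟨hσg, hσc⟩ := mem_filter.1 hσ
  obtain ⟨ht, htc⟩ := h.topSub_mem hs (show (m : ℕ) ≤ k by omega)
  have := upCount_addSimplex_of_notMem h.down hσg h.fresh hσc (h.fresh _ ht)
    (show (topSub s (m + 1)).card < m + 2 by omega)
  rw [htc, show (m : ℕ) + 2 - (m + 1) - 1 = 0 by omega, Nat.choose_zero_right] at this
  exact this

lemma IsPAState.degVec_addSimplex_new {k n : ℕ} {g : Finset (Finset ℕ)} (h : IsPAState k n g)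
    {u σ : Finset ℕ} (hσ : σ ∈ kSimplices k g) (hu : u ⊆ σ) (huc : u.card = k)
    (m : Fin (k + 1)) :
    degVec k (addSimplex g σ (n + k + 3)) (insert (n + k + 3) u) m = k - m + 1 := by
  obtain ⟨hσg, hσc⟩ := mem_filter.1 hσ
  have hvu : n + k + 3 ∉ u := fun hv => h.fresh σ hσg (hu hv)
  have hmax : ∀ w ∈ insert (n + k + 3) u, w ≤ n + k + 3 := by
    intro w hw
    rcases mem_insert.1 hw with rfl | hw
    · rfl
    · exact (h.vert σ hσg w (hu hw)).le
  have htc := card_topSub (s := insert (n + k + 3) u) (c := m + 1)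
    (by rw [card_insert_of_notMem hvu]; omega)
  have := upCount_addSimplex_of_mem (j := m + 2) h.down hσg h.fresh hσc
    (mem_topSub_of_forall_le (mem_insert_self _ u) hmax (by omega : 0 < (m : ℕ) + 1))
    ((topSub_subset _ _).trans (insert_subset_insert _ hu)) (by omega)
  rw [htc, show (m : ℕ) + 2 - (m + 1) = 1 by omega, Nat.choose_one_right] at this
  exact this.trans (by omega)

lemma IsPAState.Ncount_addSimplex {k n : ℕ} {g : Finset (Finset ℕ)} (h : IsPAState k n g)
    {σ : Finset ℕ} (hσ : σ ∈ kSimplices k g) (i : Fin (k + 1) → ℕ) :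
    Ncount k (addSimplex g σ (n + k + 3)) i =
      #{s ∈ kSimplices k g | ∀ m : Fin (k + 1),
        degVec k g s m + (if topSub s (m + 1) ⊆ σ then 1 else 0) = i m} +
      if ∀ ℓ : Fin (k + 1), i ℓ = k - (ℓ : ℕ) + 1 then k + 1 else 0 := by
  obtain ⟨hσg, hσc⟩ := mem_filter.1 hσ
  rw [Ncount_eq, kSimplices, filter_filter, card_filter_addSimplex h.down hσg h.fresh]
  congr 1
  · rw [← filter_filter, ← kSimplices]
    congr 1
    refine filter_congr fun s hs => ?_
    rw [funext_iff]
    simp only [h.degVec_addSimplex hs hσ]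
  · have hnew : ∀ u ∈ σ.powerset, (insert (n + k + 3) u).card = k + 1 ↔ u.card = k := by
      intro u hu
      rw [card_insert_of_notMem fun hv => h.fresh σ hσg (mem_powerset.1 hu hv)]
      omega
    split_ifs with hi
    · have hcard : #(powersetCard k σ) = k + 1 := by
        rw [card_powersetCard, hσc, Nat.choose_succ_self_right]
      refine Eq.trans (congrArg card ?_) hcard
      ext u
      rw [mem_filter, mem_powersetCard, mem_powerset]
      constructor
      · exact fun hu => ⟨hu.1, (hnew u (mem_powerset.2 hu.1)).1 hu.2.1⟩
      · exact fun hu => ⟨hu.1, (hnew u (mem_powerset.2 hu.1)).2 hu.2, funext fun m => by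
          rw [h.degVec_addSimplex_new hσ hu.1 hu.2, hi]⟩
    · rw [card_eq_zero, filter_eq_empty_iff]
      rintro u hu ⟨hc, rfl⟩
      exact hi fun ℓ => h.degVec_addSimplex_new hσ (mem_powerset.1 hu) ((hnew u hu).1 hc) ℓ

/-- The part of the degree recursion at `i` that involves index vectors below `i`. -/
def lowerOp (k : ℕ) (δ : ℝ) (i : Fin (k + 1) → ℕ) (f : (Fin (k + 1) → ℕ) → ℝ) : ℝ :=
  ((i (Fin.last k) : ℝ) - 1 + δ) * f (allDec k i) +
    ∑ m : Fin k,
      (((i m.castSucc : ℝ) - 1 - k + (m : ℕ)) * bcoef k δ (m : ℕ)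
        - ((i m.succ : ℝ) - k + (m : ℕ) + 1) * bcoef k δ ((m : ℕ) + 1)) * f (decUpTo k (m : ℕ) i)

/-- The weight of the `k`-simplices containing a vertex of degree `i 0`. -/
def exitRate (k : ℕ) (δ : ℝ) (i : Fin (k + 1) → ℕ) : ℝ := ((i 0 : ℝ) - k) * bcoef k δ 0 + δ

/-- The linear operator on the right-hand side of the degree recursion. -/
def recOp (k : ℕ) (δ : ℝ) (i : Fin (k + 1) → ℕ) (f : (Fin (k + 1) → ℕ) → ℝ) : ℝ :=
  lowerOp k δ i f - exitRate k δ i * f i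

lemma sum_mul_recOp {α : Type*} (S : Finset α) (c : α → ℝ) (k : ℕ) (δ : ℝ)
    (i : Fin (k + 1) → ℕ) (f : α → (Fin (k + 1) → ℕ) → ℝ) :
    ∑ a ∈ S, c a * recOp k δ i (f a) = recOp k δ i fun j => ∑ a ∈ S, c a * f a j := by
  simp only [recOp, lowerOp, mul_sub, mul_add, mul_sum, sum_sub_distrib, sum_add_distrib]
  rw [sum_comm]
  congr 1
  · congr 1
    · exact sum_congr rfl fun _ _ => by ring
    · exact sum_congr rfl fun _ _ => sum_congr rfl fun _ _ => by ring
  · exact sum_congr rfl fun _ _ => by ring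

lemma lowerOp_add_mul (k : ℕ) (δ : ℝ) (i : Fin (k + 1) → ℕ) (f g : (Fin (k + 1) → ℕ) → ℝ)
    (c : ℝ) : lowerOp k δ i (fun j => f j + c * g j) = lowerOp k δ i f + c * lowerOp k δ i g := by
  simp only [lowerOp, mul_add, mul_sum, sum_add_distrib]
  have : ∀ a b x : ℝ, a * (b * x) = b * (a * x) := fun a b x => by ring
  simp only [this _ c]
  ring

lemma indicator_add_eq_sum {k : ℕ} {d i : Fin (k + 1) → ℕ} (hi : ∀ m, 1 ≤ i m) {χ : ℕ → Prop}
    [DecidablePred χ] (hχ : ∀ m, χ (m + 1) → χ m) :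
    (if ∀ m : Fin (k + 1), d m + (if χ m then 1 else 0) = i m then (1 : ℝ) else 0) =
      (1 - if χ 0 then 1 else 0) * (if d = i then 1 else 0) +
      (∑ m : Fin k, ((if χ m then 1 else 0) - if χ (m + 1) then 1 else 0) *
        if d = decUpTo k m i then 1 else 0) +
      (if χ k then 1 else 0) * if d = allDec k i then 1 else 0 := by
  have hanti : ∀ a b, a ≤ b → χ b → χ a := fun a b hab => by
    induction b, hab using Nat.le_induction with
    | base => exact id
    | succ b _ ih => exact fun hb => ih (hχ b hb)
  by_cases h0 : χ 0
  · by_cases hk : χ k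
    · have hall : ∀ m, m ≤ k → χ m := fun m hm => hanti m k hm hk
      have hsum : (∑ m : Fin k, (((if χ m then 1 else 0) - if χ (m + 1) then 1 else 0) *
          if d = decUpTo k m i then 1 else 0 : ℝ)) = 0 := by
        refine sum_eq_zero fun m _ => ?_
        simp [hall m m.2.le, hall (m + 1) m.2]
      rw [hsum, if_pos h0, if_pos hk]
      simp only [sub_self, zero_mul, zero_add, one_mul]
      congr 1
      rw [eq_iff_iff, funext_iff]
      refine forall_congr' fun m => ?_
      rw [if_pos (hall m (by omega)), allDec]
      have := hi m
      omega
    · have hex : ∃ r, ¬ χ (r + 1) := ⟨k, fun h => hk (hχ k h)⟩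
      classical
      set r := Nat.find hex with hr
      have hr1 : ¬ χ (r + 1) := Nat.find_spec hex
      have hr2 : χ r := by
        rcases Nat.eq_zero_or_pos r with h | h
        · rwa [h]
        · have := Nat.find_min hex (show r - 1 < Nat.find hex by omega)
          rwa [not_not, Nat.sub_add_cancel h] at this
      have hrk : r < k := by
        by_contra h
        exact hk (hanti k r (by omega) hr2)
      have hiff : ∀ m, χ m ↔ m ≤ r := fun m =>
        ⟨fun h => by
          by_contra h'
          exact hr1 (hanti _ m (by omega) h), fun h => hanti m r h hr2⟩
      rw [Finset.sum_eq_single (⟨r, hrk⟩ : Fin k), if_pos h0, if_neg hk]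
      · simp only [sub_self, zero_mul, zero_add, add_zero, hr1, hr2, if_true, if_false, sub_zero,
          one_mul]
        congr 1
        rw [eq_iff_iff, funext_iff]
        refine forall_congr' fun m => ?_
        have := hi m
        simp only [hiff, decUpTo]
        split_ifs <;> omega
      · intro m _ hm
        have hm' : (m : ℕ) ≠ r := fun h => hm (Fin.ext h)
        have : χ m ↔ χ (m + 1) := by
          rw [hiff, hiff]
          omega
        simp [this]
      · simp
  · have hall : ∀ m, ¬ χ m := fun m hm => h0 (hanti 0 m (Nat.zero_le m) hm)
    simp [hall, funext_iff]

lemma ValidIdx.one_le {k : ℕ} {i : Fin (k + 1) → ℕ} (hi : ValidIdx k i) (m : Fin (k + 1)) :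
    1 ≤ i m := hi.1.trans (hi.2.antitone (Fin.le_last m))

lemma ValidIdx.succ_le_zero {k : ℕ} {i : Fin (k + 1) → ℕ} (hi : ValidIdx k i) :
    k + 1 ≤ i 0 := by
  have h : ∀ m : ℕ, ∀ hm : m ≤ k, m + i ⟨m, by omega⟩ ≤ i 0 := by
    intro m
    induction m with
    | zero => simp
    | succ m ih =>
      intro hm
      have h1 := ih (by omega)
      have h2 : i ⟨m + 1, by omega⟩ < i ⟨m, by omega⟩ := hi.2 (Fin.mk_lt_mk.2 (Nat.lt_succ_self m))
      omega
  have h1 := h k le_rfl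
  have h2 := hi.one_le ⟨k, by omega⟩
  omega

lemma exitRate_pos {k : ℕ} {δ : ℝ} (hδ : -1 < δ) {i : Fin (k + 1) → ℕ} (hi : ValidIdx k i) :
    0 < exitRate k δ i := by
  have h1 : ((k : ℝ) + 1) ≤ i 0 := by exact_mod_cast hi.succ_le_zero
  have hk : (0 : ℝ) ≤ k := k.cast_nonneg
  have hb : 1 ≤ bcoef k δ 0 := by
    simp only [bcoef, Nat.cast_zero, sub_zero]
    nlinarith
  rw [exitRate]
  nlinarith

lemma tauc_pos {k : ℕ} {δ : ℝ} (hδ : -1 < δ) : 1 < tauc k δ := by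
  have hk : (0 : ℝ) ≤ k := k.cast_nonneg
  rw [tauc]
  nlinarith

lemma totalWeight_pos {k : ℕ} {δ : ℝ} (hδ : -1 < δ) (n : ℕ) : 0 < tauc k δ * (n + 1) + δ := by
  have hn : (0 : ℝ) ≤ n := n.cast_nonneg
  nlinarith [tauc_pos (k := k) hδ]

lemma IsPAState.sum_weight_mul_indicator {k n : ℕ} {g : Finset (Finset ℕ)}
    (h : IsPAState k n g) (δ : ℝ) {s : Finset ℕ} (hs : s ∈ kSimplices k g)
    {i : Fin (k + 1) → ℕ} (hi : ValidIdx k i) :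
    ∑ σ ∈ kSimplices k g, ((simDeg k g σ : ℝ) + δ) *
      (if ∀ m : Fin (k + 1),
        degVec k g s m + (if topSub s (m + 1) ⊆ σ then 1 else 0) = i m then (1 : ℝ) else 0) =
      (tauc k δ * (n + 1) + δ) * (if degVec k g s = i then 1 else 0) +
        recOp k δ i fun j => if degVec k g s = j then 1 else 0 := by
  have hW : ∀ a : Finset ℕ, ∑ σ ∈ kSimplices k g, ((simDeg k g σ : ℝ) + δ) *
      (if a ⊆ σ then 1 else 0) = simWeight k δ g a := by
    intro a
    rw [simWeight, sum_filter]
    exact sum_congr rfl fun _ _ => by split_ifs <;> simp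
  have hWdeg : ∀ m : Fin (k + 1), simWeight k δ g (topSub s (m + 1)) =
      ((degVec k g s m : ℝ) - k + (m : ℕ)) * bcoef k δ m + δ := fun m =>
    h.simWeight_simplex δ (h.topSub_mem hs (by omega)).1 (h.topSub_mem hs (by omega)).2 (by omega)
  have hstep : ∑ σ ∈ kSimplices k g, ((simDeg k g σ : ℝ) + δ) *
      (if ∀ m : Fin (k + 1),
        degVec k g s m + (if topSub s (m + 1) ⊆ σ then 1 else 0) = i m then (1 : ℝ) else 0) =
      ((tauc k δ * (n + 1) + δ) - simWeight k δ g (topSub s (0 + 1))) *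
        (if degVec k g s = i then 1 else 0) +
      (∑ m : Fin k, (simWeight k δ g (topSub s (m + 1)) -
        simWeight k δ g (topSub s (m + 1 + 1))) * if degVec k g s = decUpTo k m i then 1 else 0) +
      simWeight k δ g (topSub s (k + 1)) * if degVec k g s = allDec k i then 1 else 0 := by
    have hind := fun σ => indicator_add_eq_sum (d := degVec k g s) (i := i) hi.one_le
      (χ := fun m => topSub s (m + 1) ⊆ σ)
      (fun m hm => (topSub_mono s (Nat.le_succ _)).trans hm)
    simp only [hind, mul_add, sum_add_distrib, mul_sum, ← mul_assoc, mul_sub, mul_one,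
      ← sum_mul, sum_sub_distrib, hW, h.simWeight_total]
    congr 2
    rw [sum_comm]
    simp only [← sum_mul, sum_sub_distrib, hW]
  rw [hstep, recOp, lowerOp, exitRate]
  have e0 : simWeight k δ g (topSub s (0 + 1)) * (if degVec k g s = i then 1 else 0) =
      (((i 0 : ℝ) - k) * bcoef k δ 0 + δ) * (if degVec k g s = i then 1 else 0) := by
    split_ifs with hd
    · have := hWdeg 0
      rw [hd] at this
      simpa using this
    · simp
  have ek : simWeight k δ g (topSub s (k + 1)) * (if degVec k g s = allDec k i then 1 else 0) =
      ((i (Fin.last k) : ℝ) - 1 + δ) * (if degVec k g s = allDec k i then 1 else 0) := by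
    split_ifs with hd
    · have := hWdeg (Fin.last k)
      rw [hd, allDec, Nat.cast_sub (hi.one_le _), Fin.val_last] at this
      rw [this, bcoef]
      push_cast
      ring
    · simp
  have em : ∀ m : Fin k, (simWeight k δ g (topSub s (m + 1)) -
        simWeight k δ g (topSub s (m + 1 + 1))) *
          (if degVec k g s = decUpTo k m i then (1 : ℝ) else 0) =
      (((i m.castSucc : ℝ) - 1 - k + (m : ℕ)) * bcoef k δ (m : ℕ)
        - ((i m.succ : ℝ) - k + (m : ℕ) + 1) * bcoef k δ ((m : ℕ) + 1)) *
          (if degVec k g s = decUpTo k m i then 1 else 0) := by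
    intro m
    split_ifs with hd
    · have h1 := hWdeg m.castSucc
      have h2 := hWdeg m.succ
      rw [hd, decUpTo] at h1 h2
      simp only [Fin.val_castSucc, le_refl, if_true, Nat.cast_sub (hi.one_le _), Nat.cast_one]
        at h1
      rw [if_neg (by simp)] at h2
      simp only [Fin.val_succ, Nat.cast_add, Nat.cast_one] at h2
      rw [h1, h2]
      ring
    · simp
  rw [sub_mul, e0, ek, sum_congr rfl fun m _ => em m]
  ring

lemma IsPAState.sum_prob_mul_Ncount {k n : ℕ} {g : Finset (Finset ℕ)} (h : IsPAState k n g)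
    {δ : ℝ} (hδ : -1 < δ) {i : Fin (k + 1) → ℕ} (hi : ValidIdx k i) :
    ∑ σ ∈ kSimplices k g, ((simDeg k g σ : ℝ) + δ) / (tauc k δ * (n + 1) + δ) *
      Ncount k (addSimplex g σ (n + k + 3)) i =
    Ncount k g i + recOp k δ i (fun j => Ncount k g j) / (tauc k δ * (n + 1) + δ) +
      ((k : ℝ) + 1) * if ∀ ℓ : Fin (k + 1), i ℓ = k - (ℓ : ℕ) + 1 then 1 else 0 := by
  have hT := (totalWeight_pos (k := k) hδ n).ne'
  set T := tauc k δ * (n + 1) + δ with hTdef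
  set I : ℝ := if ∀ ℓ : Fin (k + 1), i ℓ = k - (ℓ : ℕ) + 1 then 1 else 0 with hI
  have hN : ∀ j, (Ncount k g j : ℝ) =
      ∑ s ∈ kSimplices k g, 1 * if degVec k g s = j then (1 : ℝ) else 0 := by
    intro j
    simp [Ncount_eq]
  have hN' : ∀ σ ∈ kSimplices k g, (Ncount k (addSimplex g σ (n + k + 3)) i : ℝ) =
      (∑ s ∈ kSimplices k g, if ∀ m : Fin (k + 1),
        degVec k g s m + (if topSub s (m + 1) ⊆ σ then 1 else 0) = i m then (1 : ℝ) else 0) +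
        ((k : ℝ) + 1) * I := by
    intro σ hσ
    rw [h.Ncount_addSimplex hσ, Nat.cast_add, ← sum_boole, hI]
    congr 1
    split_ifs <;> simp
  have h1 : ∑ σ ∈ kSimplices k g, ((simDeg k g σ : ℝ) + δ) *
      Ncount k (addSimplex g σ (n + k + 3)) i =
      T * Ncount k g i + recOp k δ i (fun j => Ncount k g j) + T * (((k : ℝ) + 1) * I) := by
    rw [sum_congr rfl fun σ hσ => by rw [hN' σ hσ]]
    simp only [mul_add, sum_add_distrib, mul_sum (s := kSimplices k g)]
    rw [sum_comm, sum_congr rfl fun s hs => h.sum_weight_mul_indicator δ hs hi]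
    simp only [hN]
    rw [← sum_mul_recOp, sum_add_distrib, mul_sum, hTdef, ← h.simWeight_total δ, sum_mul]
    simp only [one_mul]
  simp only [div_mul_eq_mul_div]
  rw [← sum_div, h1]
  field_simp

lemma PAComplex.G_eq_filter {k : ℕ} {δ : ℝ} {Ω : Type*} [MeasurableSpace Ω]
    (M : PAComplex k δ Ω) (ω : Ω) {j n : ℕ} (hjn : j ≤ n) :
    M.G j ω = {t ∈ M.G n ω | ∀ v ∈ t, v < j + k + 3} := by
  induction n, hjn using Nat.le_induction with
  | base => exact (filter_true_of_mem (M.isPAState j ω).vert).symm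
  | succ n hjn ih =>
    rw [ih, M.step (n + 1) ω (by omega)]
    have hσ := (mem_filter.1 (M.choice_mem (n + 1) ω (by omega))).1
    ext t
    simp only [addSimplex, mem_filter, mem_union, mem_powerset, Nat.add_sub_cancel] at hσ ⊢
    constructor
    · exact fun ht => ⟨Or.inl ht.1, ht.2⟩
    · rintro ⟨ht | ⟨ht, hne⟩, hv⟩
      · exact ⟨ht, hv⟩
      · refine ⟨(M.isPAState n ω).down _ hσ t ((subset_insert_iff_of_notMem fun hmem => ?_).1 ht)
          hne, hv⟩
        have := hv _ hmem
        omega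

lemma PAComplex.measureReal_choice {k : ℕ} {δ : ℝ} (hδ : -1 < δ) {Ω : Type*} [MeasurableSpace Ω]
    (M : PAComplex k δ Ω) (n : ℕ) (g : Finset (Finset ℕ)) {s : Finset ℕ}
    (hs : s ∈ kSimplices k g) :
    M.μ.real {ω | M.G n ω = g ∧ M.choice (n + 1) ω = s} =
      ((simDeg k g s : ℝ) + δ) / (tauc k δ * (n + 1) + δ) * M.μ.real {ω | M.G n ω = g} := by
  by_cases hne : ∃ ω₀, M.G n ω₀ = g
  · obtain ⟨ω₀, rfl⟩ := hne
    have hiff : ∀ ω, (∀ j < n + 1, M.G j ω = M.G j ω₀) ↔ M.G n ω = M.G n ω₀ := by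
      intro ω
      refine ⟨fun h => h n (Nat.lt_succ_self n), fun h j hj => ?_⟩
      rw [M.G_eq_filter ω (Nat.lt_succ_iff.1 hj), M.G_eq_filter ω₀ (Nat.lt_succ_iff.1 hj), h]
    have hlaw := M.cond_law (n + 1) (by omega) (fun j => M.G j ω₀) s hs
    simp only [hiff, Nat.add_sub_cancel] at hlaw
    have hst := M.isPAState n ω₀
    obtain ⟨hsg, hsc⟩ := mem_filter.1 hs
    have hdeg : (1 : ℝ) ≤ simDeg k (M.G n ω₀) s := by
      rw [hst.simDeg_eq hsg hsc le_rfl]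
      exact_mod_cast (hst.pos s hsg hsc.le).trans (Nat.le_add_right _ _)
    rw [hst.simWeight_total] at hlaw
    simp only [measureReal_def, and_comm (a := M.G n _ = _)]
    rw [hlaw, ENNReal.toReal_mul, ENNReal.toReal_ofReal]
    exact div_nonneg (by linarith) (totalWeight_pos hδ n).le
  · have h0 : ∀ ω, M.G n ω ≠ g := fun ω h => hne ⟨ω, h⟩
    simp [h0]

lemma integral_comp_eq_sum {Ω α : Type*} [MeasurableSpace Ω] (μ : Measure Ω)
    [IsProbabilityMeasure μ] (X : Ω → α) (S : Finset α) (hX : ∀ ω, X ω ∈ S)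
    (hmeas : ∀ a ∈ S, MeasurableSet {ω | X ω = a}) (f : α → ℝ) :
    ∫ ω, f (X ω) ∂μ = ∑ a ∈ S, μ.real {ω | X ω = a} * f a := by
  classical
  have h : ∀ ω, f (X ω) = ∑ a ∈ S, {ω | X ω = a}.indicator (fun _ => f a) ω := by
    intro ω
    simp [Set.indicator_apply, hX ω]
  simp only [h]
  rw [integral_finsetSum _ fun a ha => (integrable_const _).indicator (hmeas a ha)]
  exact sum_congr rfl fun a ha => by rw [integral_indicator_const _ (hmeas a ha), smul_eq_mul]

/-- A finite set containing all possible states at time `n`. -/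
def paStates (k n : ℕ) : Finset (Finset (Finset ℕ)) := (range (n + k + 3)).powerset.powerset

lemma PAComplex.G_mem_paStates {k : ℕ} {δ : ℝ} {Ω : Type*} [MeasurableSpace Ω]
    (M : PAComplex k δ Ω) (n : ℕ) (ω : Ω) : M.G n ω ∈ paStates k n :=
  mem_powerset.2 fun t ht => mem_powerset.2 fun v hv =>
    mem_range.2 ((M.isPAState n ω).vert t ht v hv)

lemma PAComplex.measurableSet_G_eq {k : ℕ} {δ : ℝ} {Ω : Type*} [MeasurableSpace Ω]
    (M : PAComplex k δ Ω) (n : ℕ) (g : Finset (Finset ℕ)) : MeasurableSet {ω | M.G n ω = g} :=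
  M.meas_G n (MeasurableSpace.measurableSet_top (s := {g}))

lemma PAComplex.measurableSet_choice_eq {k : ℕ} {δ : ℝ} {Ω : Type*} [MeasurableSpace Ω]
    (M : PAComplex k δ Ω) (n : ℕ) (s : Finset ℕ) : MeasurableSet {ω | M.choice n ω = s} :=
  M.meas_choice n (MeasurableSpace.measurableSet_top (s := {s}))

lemma PAComplex.integral_Ncount {k : ℕ} {δ : ℝ} {Ω : Type*} [MeasurableSpace Ω]
    (M : PAComplex k δ Ω) (n : ℕ) (i : Fin (k + 1) → ℕ) :
    ∫ ω, (Ncount k (M.G n ω) i : ℝ) ∂M.μ =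
      ∑ g ∈ paStates k n, M.μ.real {ω | M.G n ω = g} * Ncount k g i :=
  have := M.isProb
  integral_comp_eq_sum M.μ (M.G n) (paStates k n) (M.G_mem_paStates n)
    (fun g _ => M.measurableSet_G_eq n g) fun g => (Ncount k g i : ℝ)

lemma PAComplex.integral_Ncount_succ {k : ℕ} {δ : ℝ} (hδ : -1 < δ) {Ω : Type*}
    [MeasurableSpace Ω] (M : PAComplex k δ Ω) (n : ℕ) {i : Fin (k + 1) → ℕ}
    (hi : ValidIdx k i) :
    ∫ ω, (Ncount k (M.G (n + 1) ω) i : ℝ) ∂M.μ =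
      ∫ ω, (Ncount k (M.G n ω) i : ℝ) ∂M.μ +
        recOp k δ i (fun j => ∫ ω, (Ncount k (M.G n ω) j : ℝ) ∂M.μ) /
          (tauc k δ * (n + 1) + δ) +
        ((k : ℝ) + 1) * if ∀ ℓ : Fin (k + 1), i ℓ = k - (ℓ : ℕ) + 1 then 1 else 0 := by
  have := M.isProb
  have hstep : ∀ ω, M.G (n + 1) ω =
      addSimplex (M.G n ω) (M.choice (n + 1) ω) (n + k + 3) := by
    intro ω
    rw [M.step (n + 1) ω (by omega), show n + 1 + k + 2 = n + k + 3 by omega]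
    rfl
  have hjoint := integral_comp_eq_sum M.μ
    (fun ω => (⟨M.G n ω, M.choice (n + 1) ω⟩ : (_ : Finset (Finset ℕ)) × Finset ℕ))
    ((paStates k n).sigma fun g => kSimplices k g)
    (fun ω => mem_sigma.2 ⟨M.G_mem_paStates n ω, M.choice_mem (n + 1) ω (by omega)⟩)
    (fun a _ => by
      obtain ⟨g, s⟩ := a
      simp only [Sigma.mk.injEq, heq_eq_eq]
      exact (M.measurableSet_G_eq n g).inter (M.measurableSet_choice_eq (n + 1) s))
    (fun a => (Ncount k (addSimplex a.1 a.2 (n + k + 3)) i : ℝ))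
  simp only [← hstep] at hjoint
  rw [hjoint, sum_sigma]
  simp only [Sigma.mk.injEq, heq_eq_eq, M.integral_Ncount n]
  rw [← sum_mul_recOp, sum_div, ← sum_add_distrib]
  have htotal : ∑ g ∈ paStates k n, M.μ.real {ω | M.G n ω = g} = 1 := by
    have := integral_comp_eq_sum M.μ (M.G n) (paStates k n) (M.G_mem_paStates n)
      (fun g _ => M.measurableSet_G_eq n g) fun _ => (1 : ℝ)
    simpa using this.symm
  set I : ℝ := ((k : ℝ) + 1) * if ∀ ℓ : Fin (k + 1), i ℓ = k - (ℓ : ℕ) + 1 then 1 else 0 with hI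
  have hIsum : I = ∑ g ∈ paStates k n, M.μ.real {ω | M.G n ω = g} * I := by
    rw [← sum_mul, htotal, one_mul]
  rw [hIsum, ← sum_add_distrib]
  refine sum_congr rfl fun g _ => ?_
  by_cases hne : ∃ ω₀, M.G n ω₀ = g
  · obtain ⟨ω₀, rfl⟩ := hne
    rw [mul_div_assoc, ← mul_add, ← mul_add, hI, ← (M.isPAState n ω₀).sum_prob_mul_Ncount hδ hi,
      mul_sum]
    refine sum_congr rfl fun s hs => ?_
    rw [M.measureReal_choice hδ n _ hs]
    ring
  · have h0 : ∀ ω, M.G n ω ≠ g := fun ω h => hne ⟨ω, h⟩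
    simp [h0]

lemma LimitRecursion.eq_recOp {k : ℕ} {δ : ℝ} {p : (Fin (k + 1) → ℕ) → ℝ}
    (hp : LimitRecursion k δ p) {i : Fin (k + 1) → ℕ} (hi : ValidIdx k i) :
    p i = recOp k δ i p / tauc k δ +
      if ∀ ℓ : Fin (k + 1), i ℓ = k - (ℓ : ℕ) + 1 then 1 else 0 := by
  have h := hp.2 i hi
  simp only [div_mul_eq_mul_div, ← sum_div] at h
  rw [recOp, lowerOp, exitRate, sub_div, add_div]
  exact h

lemma bounded_of_contracting_recursion {e R T : ℕ → ℝ} {w C : ℝ} (hw : 0 < w)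
    (hT : ∀ n, 0 < T n) (hlarge : ∀ᶠ n in atTop, w ≤ T n)
    (hrec : ∀ n, e (n + 1) = e n * (1 - w / T n) + R n / T n) (hR : ∀ n, |R n| ≤ C) :
    ∃ C', ∀ n, |e n| ≤ C' := by
  obtain ⟨N, hN⟩ := eventually_atTop.1 hlarge
  have hC : 0 ≤ C := (abs_nonneg _).trans (hR 0)
  set B := ∑ n ∈ range (N + 1), |e n| + C / w with hB
  have hsmall : ∀ n ≤ N, |e n| ≤ B := fun n hn =>
    (single_le_sum (f := fun n => |e n|) (fun _ _ => abs_nonneg _)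
      (mem_range.2 (Nat.lt_succ_of_le hn))).trans (le_add_of_nonneg_right (by positivity))
  have hCB : C ≤ w * B := by
    rw [← div_le_iff₀' hw, hB]
    exact le_add_of_nonneg_left (sum_nonneg fun _ _ => abs_nonneg _)
  have hbig : ∀ n, N ≤ n → |e n| ≤ B := by
    intro n hn
    induction n, hn using Nat.le_induction with
    | base => exact hsmall N le_rfl
    | succ n hn ih =>
      have h1 : 0 ≤ 1 - w / T n := sub_nonneg.2 ((div_le_one (hT n)).2 (hN n hn))
      calc |e (n + 1)| ≤ |e n * (1 - w / T n)| + |R n / T n| := by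
            rw [hrec]
            exact abs_add_le _ _
        _ = |e n| * (1 - w / T n) + |R n| / T n := by
            rw [abs_mul, abs_div, abs_of_nonneg h1, abs_of_pos (hT n)]
        _ ≤ B * (1 - w / T n) + w * B / T n := by
            have := hT n
            have := (hR n).trans hCB
            gcongr
        _ = B := by ring
  exact ⟨B, fun n => (le_total n N).elim (hsmall n) (hbig n)⟩

lemma lowerOp_bounded {k : ℕ} {δ : ℝ} {i : Fin (k + 1) → ℕ}
    {f : ℕ → (Fin (k + 1) → ℕ) → ℝ}
    (hall : ∃ C, ∀ n, |f n (allDec k i)| ≤ C)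
    (hdec : ∀ m : Fin k, ∃ C, ∀ n, |f n (decUpTo k m i)| ≤ C) :
    ∃ C, ∀ n, |lowerOp k δ i (f n)| ≤ C := by
  obtain ⟨C, hC⟩ := hall
  choose D hD using hdec
  refine ⟨|(i (Fin.last k) : ℝ) - 1 + δ| * C +
    ∑ m : Fin k, |((i m.castSucc : ℝ) - 1 - k + (m : ℕ)) * bcoef k δ (m : ℕ)
      - ((i m.succ : ℝ) - k + (m : ℕ) + 1) * bcoef k δ ((m : ℕ) + 1)| * D m,
    fun n => (abs_add_le _ _).trans (add_le_add ?_ ((abs_sum_le_sum_abs _ _).trans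
      (sum_le_sum fun m _ => ?_)))⟩
  · rw [abs_mul]
    exact mul_le_mul_of_nonneg_left (hC n) (abs_nonneg _)
  · rw [abs_mul]
    exact mul_le_mul_of_nonneg_left (hD m n) (abs_nonneg _)

lemma PAComplex.error_bounded {k : ℕ} {δ : ℝ} (hδ : -1 < δ) {Ω : Type*} [MeasurableSpace Ω]
    (M : PAComplex k δ Ω) {p : (Fin (k + 1) → ℕ) → ℝ} (hp : LimitRecursion k δ p) (N : ℕ) :
    ∀ i : Fin (k + 1) → ℕ, i 0 < N →
      ∃ C, ∀ n : ℕ, |(∫ ω, (Ncount k (M.G n ω) i : ℝ) ∂M.μ) - n * ((k : ℝ) + 1) * p i| ≤ C := by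
  induction N with
  | zero => exact fun i hi => absurd hi (Nat.not_lt_zero _)
  | succ N ih =>
    intro i hiN
    by_cases hi : ValidIdx k i
    swap
    · refine ⟨0, fun n => ?_⟩
      simp [hp.1 i hi, (M.isPAState n _).Ncount_eq_zero hi]
    have hi0 := hi.one_le 0
    set e : ℕ → (Fin (k + 1) → ℕ) → ℝ := fun n j =>
      (∫ ω, (Ncount k (M.G n ω) j : ℝ) ∂M.μ) - n * ((k : ℝ) + 1) * p j with he
    have hlow := lowerOp_bounded (δ := δ) (f := e) (i := i)
      (ih _ (by simp only [allDec]; omega))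
      (fun m => ih _ (by simp only [decUpTo, Fin.val_zero, zero_le, if_true]; omega))
    obtain ⟨C, hC⟩ := hlow
    have hτ := tauc_pos (k := k) hδ
    set c := ((k : ℝ) + 1) * recOp k δ i p * (tauc k δ + δ) / tauc k δ with hc
    refine bounded_of_contracting_recursion (e := fun n => e n i)
      (R := fun n => lowerOp k δ i (e n) - c) (T := fun n => tauc k δ * (n + 1) + δ)
      (C := C + |c|) (exitRate_pos hδ hi) (totalWeight_pos hδ) ?_ ?_
      fun n => (abs_sub _ _).trans (add_le_add_left (hC n) _)
    · refine Tendsto.eventually_ge_atTop ?_ _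
      refine tendsto_atTop_add_const_right _ _ (Tendsto.const_mul_atTop (by linarith) ?_)
      exact tendsto_atTop_add_const_right _ _ tendsto_natCast_atTop_atTop
    · intro n
      have hx : ∀ j, (∫ ω, (Ncount k (M.G n ω) j : ℝ) ∂M.μ) =
          e n j + n * ((k : ℝ) + 1) * p j := fun j => by rw [he]; ring
      have hstep := M.integral_Ncount_succ hδ n hi
      have hI := hp.eq_recOp hi
      have hT := (totalWeight_pos (k := k) hδ n).ne'
      simp only [hx] at hstep
      rw [recOp, lowerOp_add_mul] at hstep
      have hen : e (n + 1) i = (∫ ω, (Ncount k (M.G (n + 1) ω) i : ℝ) ∂M.μ) -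
          ((n : ℝ) + 1) * ((k : ℝ) + 1) * p i := by
        simp only [he]
        push_cast
        ring
      rw [hen, hstep, hc, ← sub_eq_iff_eq_add'.2 hI, recOp]
      field_simp
      ring

/-- For every fixed valid index vector, the sequence
`(E[N_n(i_0,…,i_k)] - n(k+1) p_{i_0,…,i_k})_{n ≥ 1}` is bounded, where `p` is the
solution of the limiting degree recursion. -/
theorem expected_degree_counts_bounded_error (k : ℕ) (δ : ℝ) (hδ : -1 < δ)
    (Ω : Type*) [MeasurableSpace Ω] (M : PAComplex k δ Ω)
    (i : Fin (k + 1) → ℕ) (hi : ValidIdx k i)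
    (p : (Fin (k + 1) → ℕ) → ℝ) (hp : LimitRecursion k δ p) :
    ∃ C : ℝ, ∀ n : ℕ, 1 ≤ n →
      |(∫ ω, (Ncount k (M.G n ω) i : ℝ) ∂M.μ) - n * ((k : ℝ) + 1) * p i| ≤ C := by
  obtain ⟨C, hC⟩ := M.error_bounded hδ hp (i 0 + 1) i (Nat.lt_succ_self _)
  exact ⟨C, fun n _ => hC n⟩
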